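/- (Lemma 4.7(i), elastic observability-type inequality) Consider the full Dirichlet boundary conditions. Let λ ∈ ℝ, Û ∈ ℋ, and let U = (φ,Φ,ψ,Ψ,θ,η,ξ,ζ) ∈ D(𝒜) satisfy the resolvent equation iλU − 𝒜U = Û. Defining 𝓘(φ,ψ) = |φx(0)+ψ(0)|² + |φx(L)+ψ(L)|², one has 𝓘(φ,ψ) ≤ c‖U‖²_ℋ + c‖U‖_ℋ ‖Û‖_ℋ + c‖U‖_ℋ ‖θx‖ for some structural constant c > 0 independent of λ, U and Û. -/

import Mathlib

/-!
Shared setting: thermoelastic Timoshenko–Gurtin–Pipkin system on (0,L),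
history space framework of Dafermos.  Functions on (0,L) are represented as
maps `ℝ → ℂ`, memory variables as maps `ℝ → ℝ → ℂ` (first argument the
history variable `s`, second the space variable `x`).
-/

open MeasureTheory Set Filter

noncomputable section

namespace TGP

/-- L² norm squared on (0,L). -/
def L2normSq (L : ℝ) (f : ℝ → ℂ) : ℝ := ∫ x in Ioo 0 L, ‖f x‖ ^ 2

/-- L² norm on (0,L). -/
def L2norm (L : ℝ) (f : ℝ → ℂ) : ℝ := Real.sqrt (L2normSq L f)

/-- L² inner product on (0,L). -/
def L2inner (L : ℝ) (f g : ℝ → ℂ) : ℂ :=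
  ∫ x in Ioo 0 L, (starRingEnd ℂ) (g x) * f x

/-- Weighted memory-space norm squared: `∫₀^∞ w(s) ‖ηx(s)‖² ds`. -/
def MnormSq (L : ℝ) (w : ℝ → ℝ) (η : ℝ → ℝ → ℂ) : ℝ :=
  ∫ s in Ioi (0 : ℝ), w s * L2normSq L (deriv (η s))

/-- Weighted memory-space norm. -/
def Mnorm (L : ℝ) (w : ℝ → ℝ) (η : ℝ → ℝ → ℂ) : ℝ := Real.sqrt (MnormSq L w η)

/-- Weighted memory-space inner product: `∫₀^∞ w(s) ⟨η1x(s), η2x(s)⟩ ds`. -/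
def Minner (L : ℝ) (w : ℝ → ℝ) (η1 η2 : ℝ → ℝ → ℂ) : ℂ :=
  ∫ s in Ioi (0 : ℝ), (w s : ℂ) * L2inner L (deriv (η1 s)) (deriv (η2 s))

/-- The functional `Γ[η] = ∫₀^∞ (−w'(s)) ‖ηx(s)‖² ds`. -/
def Gam (L : ℝ) (w : ℝ → ℝ) (η : ℝ → ℝ → ℂ) : ℝ :=
  ∫ s in Ioi (0 : ℝ), (-(deriv w s)) * L2normSq L (deriv (η s))

/-- Structural parameters of the model, including the assumptions on the
memory kernels μ and ν. -/
structure Params where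
  L : ℝ
  rho1 : ℝ
  rho2 : ℝ
  rho3 : ℝ
  rho4 : ℝ
  k : ℝ
  b : ℝ
  gamma : ℝ
  sigma : ℝ
  w1 : ℝ
  w2 : ℝ
  delta1 : ℝ
  delta2 : ℝ
  mu : ℝ → ℝ
  nu : ℝ → ℝ
  hL : 0 < L
  hrho1 : 0 < rho1
  hrho2 : 0 < rho2
  hrho3 : 0 < rho3
  hrho4 : 0 < rho4
  hk : 0 < k
  hb : 0 < b
  hgamma : 0 < gamma
  hsigma : 0 < sigma
  hw1 : 0 < w1
  hw2 : 0 < w2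
  hdelta1 : 0 < delta1
  hdelta2 : 0 < delta2
  hmu_nonneg : ∀ s ∈ Ioi (0 : ℝ), 0 ≤ mu s
  hnu_nonneg : ∀ s ∈ Ioi (0 : ℝ), 0 ≤ nu s
  hmu_mono : AntitoneOn mu (Ioi 0)
  hnu_mono : AntitoneOn nu (Ioi 0)
  hmu_int : IntegrableOn mu (Ioi 0)
  hnu_int : IntegrableOn nu (Ioi 0)
  -- absolute continuity on (0,∞), expressed through the fundamental
  -- theorem of calculus for the a.e. derivative
  hmu_ac : ∀ a c : ℝ, 0 < a → a ≤ c → mu c - mu a = ∫ s in a..c, deriv mu s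
  hnu_ac : ∀ a c : ℝ, 0 < a → a ≤ c → nu c - nu a = ∫ s in a..c, deriv nu s
  -- the Dafermos conditions μ' + δ₁ μ ≤ 0, ν' + δ₂ ν ≤ 0 a.e.
  hmu_daf : ∀ᵐ s ∂(volume.restrict (Ioi (0 : ℝ))), deriv mu s + delta1 * mu s ≤ 0
  hnu_daf : ∀ᵐ s ∂(volume.restrict (Ioi (0 : ℝ))), deriv nu s + delta2 * nu s ≤ 0

/-- The two kinds of boundary conditions considered. -/
inductive BC
  | mixed     -- mixed Dirichlet–Neumann boundary conditions
  | dirichlet -- full Dirichlet boundary conditions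

/-- A state `U = (φ, Φ, ψ, Ψ, θ, η, ξ, ζ)`. -/
structure State where
  phi : ℝ → ℂ
  Phi : ℝ → ℂ
  psi : ℝ → ℂ
  Psi : ℝ → ℂ
  theta : ℝ → ℂ
  eta : ℝ → ℝ → ℂ
  xi : ℝ → ℂ
  zeta : ℝ → ℝ → ℂ

instance : Sub State :=
  ⟨fun U V =>
    { phi := U.phi - V.phi
      Phi := U.Phi - V.Phi
      psi := U.psi - V.psi
      Psi := U.Psi - V.Psi
      theta := U.theta - V.theta
      eta := fun s => U.eta s - V.eta s
      xi := U.xi - V.xi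
      zeta := fun s => U.zeta s - V.zeta s }⟩

instance : SMul ℂ State :=
  ⟨fun a U =>
    { phi := a • U.phi
      Phi := a • U.Phi
      psi := a • U.psi
      Psi := a • U.Psi
      theta := a • U.theta
      eta := fun s => a • U.eta s
      xi := a • U.xi
      zeta := fun s => a • U.zeta s }⟩

/-- Membership in L²(0,L). -/
def memL2 (L : ℝ) (f : ℝ → ℂ) : Prop :=
  AEStronglyMeasurable f (volume.restrict (Ioo 0 L)) ∧
  IntegrableOn (fun x => ‖f x‖ ^ 2) (Ioo 0 L)

/-- Zero mean value on (0,L) (membership in L²_*). -/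
def zeroMean (L : ℝ) (f : ℝ → ℂ) : Prop := (∫ x in Ioo 0 L, f x) = 0

/-- Membership in H¹(0,L). -/
def memH1 (L : ℝ) (f : ℝ → ℂ) : Prop :=
  ContinuousOn f (Icc 0 L) ∧ (∀ x ∈ Ioo 0 L, DifferentiableAt ℝ f x) ∧
  memL2 L f ∧ memL2 L (deriv f)

/-- Membership in H¹₀(0,L). -/
def memH10 (L : ℝ) (f : ℝ → ℂ) : Prop := memH1 L f ∧ f 0 = 0 ∧ f L = 0

/-- Membership in H¹_*(0,L) = H¹ ∩ L²_*. -/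
def memH1star (L : ℝ) (f : ℝ → ℂ) : Prop := memH1 L f ∧ zeroMean L f

/-- Membership in H²(0,L). -/
def memH2 (L : ℝ) (f : ℝ → ℂ) : Prop := memH1 L f ∧ memH1 L (deriv f)

/-- Membership in the memory space ℳ = L²_μ((0,∞); H¹_*) (mixed case) or
ℳ = L²_μ((0,∞); H¹₀) (Dirichlet case). -/
def memMS (P : Params) (bc : BC) (η : ℝ → ℝ → ℂ) : Prop :=
  (∀ s ∈ Ioi (0 : ℝ),
    match bc with
    | BC.mixed => memH1star P.L (η s)
    | BC.dirichlet => memH10 P.L (η s)) ∧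
  IntegrableOn (fun s => P.mu s * L2normSq P.L (deriv (η s))) (Ioi 0)

/-- Membership in the memory space 𝒩 = L²_ν((0,∞); H¹₀). -/
def memNS (P : Params) (ζ : ℝ → ℝ → ℂ) : Prop :=
  (∀ s ∈ Ioi (0 : ℝ), memH10 P.L (ζ s)) ∧
  IntegrableOn (fun s => P.nu s * L2normSq P.L (deriv (ζ s))) (Ioi 0)

/-- Derivative with respect to the history variable s. -/
def sDeriv (η : ℝ → ℝ → ℂ) : ℝ → ℝ → ℂ := fun s x => deriv (fun r => η r x) s

/-- The generator `T = −∂s` of the right-translation semigroup. -/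
def Top (η : ℝ → ℝ → ℂ) : ℝ → ℝ → ℂ := fun s x => -(sDeriv η s x)

/-- Membership in D(T) ⊂ ℳ : η' ∈ ℳ and ‖ηx(s)‖ → 0 as s → 0⁺. -/
def memDTM (P : Params) (bc : BC) (η : ℝ → ℝ → ℂ) : Prop :=
  memMS P bc η ∧ memMS P bc (sDeriv η) ∧
  Tendsto (fun s => L2norm P.L (deriv (η s))) (nhdsWithin 0 (Ioi 0)) (nhds 0)

/-- Membership in D(T) ⊂ 𝒩 : ζ' ∈ 𝒩 and ‖ζx(s)‖ → 0 as s → 0⁺. -/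
def memDTN (P : Params) (ζ : ℝ → ℝ → ℂ) : Prop :=
  memNS P ζ ∧ memNS P (sDeriv ζ) ∧
  Tendsto (fun s => L2norm P.L (deriv (ζ s))) (nhdsWithin 0 (Ioi 0)) (nhds 0)

/-- Membership in the state space ℋ. -/
def memHS (P : Params) (bc : BC) (U : State) : Prop :=
  memH10 P.L U.phi ∧ memL2 P.L U.Phi ∧
  (match bc with
   | BC.mixed =>
      memH1star P.L U.psi ∧ memL2 P.L U.Psi ∧ zeroMean P.L U.Psi ∧
      memL2 P.L U.theta ∧ zeroMean P.L U.theta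
   | BC.dirichlet =>
      memH10 P.L U.psi ∧ memL2 P.L U.Psi ∧ memL2 P.L U.theta) ∧
  memMS P bc U.eta ∧ memL2 P.L U.xi ∧ memNS P U.zeta

/-- The squared norm on ℋ. -/
def hnormSq (P : Params) (U : State) : ℝ :=
  P.k * L2normSq P.L (fun x => deriv U.phi x + U.psi x) +
  P.rho1 * L2normSq P.L U.Phi +
  P.b * L2normSq P.L (deriv U.psi) +
  P.rho2 * L2normSq P.L U.Psi +
  P.rho3 * L2normSq P.L U.theta +
  P.w1 * MnormSq P.L P.mu U.eta +
  P.rho4 * L2normSq P.L U.xi +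
  P.w2 * MnormSq P.L P.nu U.zeta

/-- The norm on ℋ. -/
def hnorm (P : Params) (U : State) : ℝ := Real.sqrt (hnormSq P U)

/-- The inner product on ℋ. -/
def hinner (P : Params) (U V : State) : ℂ :=
  (P.k : ℂ) * L2inner P.L (fun x => deriv U.phi x + U.psi x)
      (fun x => deriv V.phi x + V.psi x) +
  (P.rho1 : ℂ) * L2inner P.L U.Phi V.Phi +
  (P.b : ℂ) * L2inner P.L (deriv U.psi) (deriv V.psi) +
  (P.rho2 : ℂ) * L2inner P.L U.Psi V.Psi +
  (P.rho3 : ℂ) * L2inner P.L U.theta V.theta +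
  (P.w1 : ℂ) * Minner P.L P.mu U.eta V.eta +
  (P.rho4 : ℂ) * L2inner P.L U.xi V.xi +
  (P.w2 : ℂ) * Minner P.L P.nu U.zeta V.zeta

/-- `x ↦ ∫₀^∞ μ(s) η(s,x) ds`. -/
def muInt (P : Params) (η : ℝ → ℝ → ℂ) : ℝ → ℂ :=
  fun x => ∫ s in Ioi (0 : ℝ), (P.mu s : ℂ) * η s x

/-- `x ↦ ∫₀^∞ ν(s) ζ(s,x) ds`. -/
def nuInt (P : Params) (ζ : ℝ → ℝ → ℂ) : ℝ → ℂ :=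
  fun x => ∫ s in Ioi (0 : ℝ), (P.nu s : ℂ) * ζ s x

/-- The Timoshenko–Gurtin–Pipkin operator 𝒜. -/
def Aop (P : Params) (U : State) : State where
  phi := U.Phi
  Phi := fun x =>
    ((P.k / P.rho1 : ℝ) : ℂ) * deriv (fun y => deriv U.phi y + U.psi y) x -
    ((P.gamma / P.rho1 : ℝ) : ℂ) * deriv U.theta x
  psi := U.Psi
  Psi := fun x =>
    ((P.b / P.rho2 : ℝ) : ℂ) * deriv (deriv U.psi) x -
    ((P.k / P.rho2 : ℝ) : ℂ) * (deriv U.phi x + U.psi x) +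
    ((P.gamma / P.rho2 : ℝ) : ℂ) * U.theta x -
    ((P.sigma / P.rho2 : ℝ) : ℂ) * deriv U.xi x
  theta := fun x =>
    ((P.w1 / P.rho3 : ℝ) : ℂ) *
      (∫ s in Ioi (0 : ℝ), (P.mu s : ℂ) * deriv (deriv (U.eta s)) x) -
    ((P.gamma / P.rho3 : ℝ) : ℂ) * (deriv U.Phi x + U.Psi x)
  eta := fun s x => Top U.eta s x + U.theta x
  xi := fun x =>
    ((P.w2 / P.rho4 : ℝ) : ℂ) *
      (∫ s in Ioi (0 : ℝ), (P.nu s : ℂ) * deriv (deriv (U.zeta s)) x) -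
    ((P.sigma / P.rho4 : ℝ) : ℂ) * deriv U.Psi x
  zeta := fun s x => Top U.zeta s x + U.xi x

/-- The domain D(𝒜) of the operator 𝒜. -/
def memDomA (P : Params) (bc : BC) (U : State) : Prop :=
  memHS P bc U ∧ memH2 P.L U.phi ∧ memH10 P.L U.Phi ∧ memH10 P.L U.xi ∧
  memH2 P.L (nuInt P U.zeta) ∧ memDTM P bc U.eta ∧ memDTN P U.zeta ∧
  (match bc with
   | BC.mixed =>
      memH10 P.L (deriv U.psi) ∧
      memH10 P.L (fun x => ∫ s in Ioi (0 : ℝ), (P.mu s : ℂ) * deriv (U.eta s) x) ∧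
      memH1star P.L U.Psi ∧ memH1star P.L U.theta
   | BC.dirichlet =>
      memH2 P.L U.psi ∧ memH10 P.L U.Psi ∧ memH10 P.L U.theta ∧
      memH2 P.L (muInt P U.eta))

/-- a.e. equality on (0,L). -/
def aeeqL (L : ℝ) (f g : ℝ → ℂ) : Prop :=
  ∀ᵐ x ∂(volume.restrict (Ioo 0 L)), f x = g x

/-- Equality of two states as elements of ℋ (componentwise, in the respective
norms of the factor spaces). -/
def StateEqAE (P : Params) (U V : State) : Prop :=
  aeeqL P.L (fun x => deriv U.phi x + U.psi x) (fun x => deriv V.phi x + V.psi x) ∧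
  aeeqL P.L U.Phi V.Phi ∧
  aeeqL P.L (deriv U.psi) (deriv V.psi) ∧
  aeeqL P.L U.Psi V.Psi ∧
  aeeqL P.L U.theta V.theta ∧
  (∀ᵐ s ∂(volume.restrict (Ioi (0 : ℝ))), aeeqL P.L (deriv (U.eta s)) (deriv (V.eta s))) ∧
  aeeqL P.L U.xi V.xi ∧
  (∀ᵐ s ∂(volume.restrict (Ioi (0 : ℝ))), aeeqL P.L (deriv (U.zeta s)) (deriv (V.zeta s)))

/-- The resolvent equation `iλU − 𝒜U = Û` (equality in ℋ). -/
def resolventEq (P : Params) (lam : ℝ) (U Uhat : State) : Prop :=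
  StateEqAE P (((Complex.I * (lam : ℂ)) • U) - Aop P U) Uhat

/-- `α(x) = ∫₀^∞ μ(s) ηx(x,s) ds`. -/
def alphaF (P : Params) (U : State) : ℝ → ℂ :=
  fun x => ∫ s in Ioi (0 : ℝ), (P.mu s : ℂ) * deriv (U.eta s) x

/-- `β(x) = ∫₀^∞ ν(s) ζx(x,s) ds`. -/
def betaF (P : Params) (U : State) : ℝ → ℂ :=
  fun x => ∫ s in Ioi (0 : ℝ), (P.nu s : ℂ) * deriv (U.zeta s) x

/-- `𝒫(φ,ψ,α) = |α(L)||φx(L)+ψ(L)| + |α(0)||φx(0)+ψ(0)|`. -/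
def Pterm (P : Params) (U : State) : ℝ :=
  ‖alphaF P U P.L‖ * ‖deriv U.phi P.L + U.psi P.L‖ +
  ‖alphaF P U 0‖ * ‖deriv U.phi 0 + U.psi 0‖

/-- `𝒬(ψ,β) = |β(L)||ψx(L)| + |β(0)||ψx(0)|`. -/
def Qterm (P : Params) (U : State) : ℝ :=
  ‖betaF P U P.L‖ * ‖deriv U.psi P.L‖ + ‖betaF P U 0‖ * ‖deriv U.psi 0‖

/-- `𝓘(φ,ψ) = |φx(0)+ψ(0)|² + |φx(L)+ψ(L)|²`. -/
def Iterm (P : Params) (U : State) : ℝ :=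
  ‖deriv U.phi 0 + U.psi 0‖ ^ 2 + ‖deriv U.phi P.L + U.psi P.L‖ ^ 2

/-- `𝓙(ψ) = |ψx(0)|² + |ψx(L)|²`. -/
def Jterm (P : Params) (U : State) : ℝ :=
  ‖deriv U.psi 0‖ ^ 2 + ‖deriv U.psi P.L‖ ^ 2

/-- `S` is the contraction C₀-semigroup on ℋ generated by 𝒜. -/
def IsGenSemigroup (P : Params) (bc : BC) (S : ℝ → State → State) : Prop :=
  (∀ t, 0 ≤ t → ∀ U, memHS P bc U → memHS P bc (S t U)) ∧
  (∀ U, memHS P bc U → StateEqAE P (S 0 U) U) ∧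
  (∀ t s, 0 ≤ t → 0 ≤ s → ∀ U, memHS P bc U →
    StateEqAE P (S (t + s) U) (S t (S s U))) ∧
  (∀ t, 0 ≤ t → ∀ U, memHS P bc U → hnorm P (S t U) ≤ hnorm P U) ∧
  (∀ U, memHS P bc U →
    Tendsto (fun t => hnorm P (S t U - U)) (nhdsWithin 0 (Ioi 0)) (nhds 0)) ∧
  (∀ U, memDomA P bc U → ∀ t, 0 ≤ t → memDomA P bc (S t U) ∧
    Tendsto (fun h : ℝ =>
        hnorm P (((h⁻¹ : ℝ) : ℂ) • (S (t + h) U - S t U) - Aop P (S t U)))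
      (nhdsWithin 0 (Ioi 0)) (nhds 0))

/-- Continuity on [0,∞) with values in ℋ. -/
def ContH (P : Params) (F : ℝ → State) : Prop :=
  ∀ t, 0 ≤ t →
    Tendsto (fun r => hnorm P (F r - F t)) (nhdsWithin t (Ici 0)) (nhds 0)

/-- `G` is the (right) derivative of `F` on [0,∞) in the norm of ℋ. -/
def HasHDeriv (P : Params) (F G : ℝ → State) : Prop :=
  ∀ t, 0 ≤ t →
    Tendsto (fun h : ℝ =>
        hnorm P (((h⁻¹ : ℝ) : ℂ) • (F (t + h) - F t) - G t))
      (nhdsWithin 0 (Ioi 0)) (nhds 0)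

/-- `F ∈ Cᵏ([0,∞), ℋ)`. -/
def CkH (P : Params) : ℕ → (ℝ → State) → Prop
  | 0, F => ContH P F
  | (n + 1), F => ContH P F ∧ ∃ G, HasHDeriv P F G ∧ CkH P n G

/-- Membership in D(𝒜ⁿ). -/
def memDomIter (P : Params) (bc : BC) : ℕ → State → Prop
  | 0, U => memHS P bc U
  | (n + 1), U => memDomA P bc U ∧ memDomIter P bc n (Aop P U)

lemma L2normSq_nonneg (L : ℝ) (f : ℝ → ℂ) : 0 ≤ L2normSq L f :=
  integral_nonneg fun _ => by positivity

lemma L2norm_nonneg (L : ℝ) (f : ℝ → ℂ) : 0 ≤ L2norm L f := Real.sqrt_nonneg _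

lemma L2norm_sq (L : ℝ) (f : ℝ → ℂ) : L2norm L f ^ 2 = L2normSq L f :=
  Real.sq_sqrt (L2normSq_nonneg L f)

lemma MnormSq_nonneg (L : ℝ) {w : ℝ → ℝ} (hw : ∀ s ∈ Ioi (0 : ℝ), 0 ≤ w s)
    (η : ℝ → ℝ → ℂ) : 0 ≤ MnormSq L w η :=
  setIntegral_nonneg measurableSet_Ioi fun s hs => mul_nonneg (hw s hs) (L2normSq_nonneg L _)

lemma memL2.memLp {L : ℝ} {f : ℝ → ℂ} (hf : memL2 L f) :
    MemLp f 2 (volume.restrict (Ioo 0 L)) :=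
  (memLp_two_iff_integrable_sq_norm hf.1).2 hf.2

lemma memL2_of_memLp {L : ℝ} {f : ℝ → ℂ} (hf : MemLp f 2 (volume.restrict (Ioo 0 L))) :
    memL2 L f :=
  ⟨hf.1, (memLp_two_iff_integrable_sq_norm hf.1).1 hf⟩

lemma memL2.add {L : ℝ} {f g : ℝ → ℂ} (hf : memL2 L f) (hg : memL2 L g) :
    memL2 L (fun x => f x + g x) :=
  memL2_of_memLp (hf.memLp.add hg.memLp)

lemma memL2.integrableOn_norm_mul_norm {L : ℝ} {f g : ℝ → ℂ} (hf : memL2 L f)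
    (hg : memL2 L g) : IntegrableOn (fun x => ‖f x‖ * ‖g x‖) (Ioo 0 L) :=
  hf.memLp.norm.integrable_mul hg.memLp.norm

/-- Cauchy–Schwarz inequality for the moduli of two square-integrable functions. -/
lemma memL2.integral_norm_mul_norm_le {L : ℝ} {f g : ℝ → ℂ} (hf : memL2 L f)
    (hg : memL2 L g) :
    ∫ x in Ioo 0 L, ‖f x‖ * ‖g x‖ ≤ L2norm L f * L2norm L g := by
  have h := integral_mul_le_Lp_mul_Lq_of_nonneg (μ := volume.restrict (Ioo 0 L))
    Real.HolderConjugate.two_two (f := fun x => ‖f x‖) (g := fun x => ‖g x‖)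
    (Eventually.of_forall fun _ => norm_nonneg _) (Eventually.of_forall fun _ => norm_nonneg _)
    (by simpa using hf.memLp.norm) (by simpa using hg.memLp.norm)
  simpa [L2norm, L2normSq, Real.sqrt_eq_rpow] using h

lemma hnormSq_bounds (P : Params) (U : State) :
    P.k * L2normSq P.L (fun x => deriv U.phi x + U.psi x) ≤ hnormSq P U ∧
    P.rho1 * L2normSq P.L U.Phi ≤ hnormSq P U ∧
    P.rho2 * L2normSq P.L U.Psi ≤ hnormSq P U := by
  have h1 := mul_nonneg P.hk.le
    (L2normSq_nonneg P.L (fun x => deriv U.phi x + U.psi x))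
  have h2 := mul_nonneg P.hrho1.le (L2normSq_nonneg P.L U.Phi)
  have h3 := mul_nonneg P.hb.le (L2normSq_nonneg P.L (deriv U.psi))
  have h4 := mul_nonneg P.hrho2.le (L2normSq_nonneg P.L U.Psi)
  have h5 := mul_nonneg P.hrho3.le (L2normSq_nonneg P.L U.theta)
  have h6 := mul_nonneg P.hw1.le (MnormSq_nonneg P.L P.hmu_nonneg U.eta)
  have h7 := mul_nonneg P.hrho4.le (L2normSq_nonneg P.L U.xi)
  have h8 := mul_nonneg P.hw2.le (MnormSq_nonneg P.L P.hnu_nonneg U.zeta)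
  unfold hnormSq
  refine ⟨?_, ?_, ?_⟩ <;> linarith

lemma hnormSq_nonneg (P : Params) (U : State) : 0 ≤ hnormSq P U :=
  (mul_nonneg P.hrho1.le (L2normSq_nonneg P.L U.Phi)).trans (hnormSq_bounds P U).2.1

lemma L2norm_le_of_mul_L2normSq_le {a L E : ℝ} {f : ℝ → ℂ} (ha : 0 < a)
    (h : a * L2normSq L f ≤ E) : L2norm L f ≤ (√a)⁻¹ * √E := by
  rw [inv_mul_eq_div, ← Real.sqrt_div' _ ha.le]
  exact Real.sqrt_le_sqrt ((le_div_iff₀' ha).2 h)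

/-- A single constant controls the elastic components of a state by its energy norm. -/
lemma exists_L2norm_le_hnorm (P : Params) :
    ∃ M : ℝ, 0 < M ∧ ∀ U : State,
      L2norm P.L (fun x => deriv U.phi x + U.psi x) ≤ M * hnorm P U ∧
      L2norm P.L U.Phi ≤ M * hnorm P U ∧ L2norm P.L U.Psi ≤ M * hnorm P U := by
  have hk := inv_pos.2 (Real.sqrt_pos.2 P.hk)
  have h1 := inv_pos.2 (Real.sqrt_pos.2 P.hrho1)
  have h2 := inv_pos.2 (Real.sqrt_pos.2 P.hrho2)
  refine ⟨(√P.k)⁻¹ + (√P.rho1)⁻¹ + (√P.rho2)⁻¹, by positivity, fun U => ?_⟩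
  obtain ⟨b1, b2, b3⟩ := hnormSq_bounds P U
  have hN : 0 ≤ hnorm P U := Real.sqrt_nonneg _
  exact ⟨(L2norm_le_of_mul_L2normSq_le P.hk b1).trans
      (mul_le_mul_of_nonneg_right (by linarith) hN),
    (L2norm_le_of_mul_L2normSq_le P.hrho1 b2).trans
      (mul_le_mul_of_nonneg_right (by linarith) hN),
    (L2norm_le_of_mul_L2normSq_le P.hrho2 b3).trans
      (mul_le_mul_of_nonneg_right (by linarith) hN)⟩

/-- The multiplier identity in pointwise form: after inserting the two resolvent equations, the
terms carrying the spectral parameter cancel. -/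
lemma multiplier_pointwise_bound {k r g l q L : ℝ} (hr : 0 < r) (hg : 0 < g)
    (hq : |q| ≤ L / 2) {w w' F F' Ps t' wh Fh : ℂ}
    (h1 : Complex.I * l * w - F' - Ps = wh)
    (h2 : r * (Complex.I * l * F) - k * w' + g * t' = r * Fh) :
    |(k * ‖w‖ ^ 2 + r * ‖F‖ ^ 2) + q * (k * (2 * inner ℝ w w') + r * (2 * inner ℝ F F'))| ≤
      |k| * (‖w‖ * ‖w‖) + r * (‖F‖ * ‖F‖) + L * (g * (‖w‖ * ‖t'‖) + r * (‖w‖ * ‖Fh‖) +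
        r * (‖F‖ * ‖Ps‖) + r * (‖F‖ * ‖wh‖)) := by
  have hF' : F' = Complex.I * l * w - Ps - wh := by rw [← h1]; ring
  have hw' : (k : ℂ) * w' = r * (Complex.I * l * F) + g * t' - r * Fh := by rw [← h2]; ring
  have key : k * inner ℝ w w' + r * inner ℝ F F' =
      g * inner ℝ w t' - r * inner ℝ w Fh - r * inner ℝ F Ps - r * inner ℝ F wh := by
    have e1 := congrArg Complex.re hw'
    have e2 := congrArg Complex.im hw'
    simp at e1 e2
    simp only [Complex.inner, hF']
    simp
    linear_combination w.re * e1 + w.im * e2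
  have b1 := abs_real_inner_le_norm w t'
  have b2 := abs_real_inner_le_norm w Fh
  have b3 := abs_real_inner_le_norm F Ps
  have b4 := abs_real_inner_le_norm F wh
  have hS : |k * inner ℝ w w' + r * inner ℝ F F'| ≤ g * (‖w‖ * ‖t'‖) + r * (‖w‖ * ‖Fh‖) +
        r * (‖F‖ * ‖Ps‖) + r * (‖F‖ * ‖wh‖) := by
    rw [key]
    have c1 := mul_le_mul_of_nonneg_left b1 hg.le
    have c2 := mul_le_mul_of_nonneg_left b2 hr.le
    have c3 := mul_le_mul_of_nonneg_left b3 hr.le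
    have c4 := mul_le_mul_of_nonneg_left b4 hr.le
    have d : ∀ a b : ℝ, 0 < a → |a * b| = a * |b| := fun a b ha => by
      rw [abs_mul, abs_of_pos ha]
    rw [← d _ _ hg] at c1
    rw [← d _ _ hr] at c2 c3 c4
    rw [abs_le] at *
    constructor <;> linarith [c1.1, c1.2, c2.1, c2.2, c3.1, c3.2, c4.1, c4.2]
  have hq2 : |2 * q| ≤ L := by rw [abs_mul, abs_two]; linarith
  calc _ = |k * (‖w‖ * ‖w‖) + r * (‖F‖ * ‖F‖) +
            (2 * q) * (k * inner ℝ w w' + r * inner ℝ F F')| := by congr 1; ring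
    _ ≤ |k * (‖w‖ * ‖w‖)| + |r * (‖F‖ * ‖F‖)| +
            |(2 * q) * (k * inner ℝ w w' + r * inner ℝ F F')| := abs_add_three _ _ _
    _ ≤ _ := by
        rw [abs_mul k, abs_mul r, abs_mul (2 * q), abs_of_pos hr, abs_of_nonneg (mul_self_nonneg ‖w‖),
          abs_of_nonneg (mul_self_nonneg ‖F‖)]
        gcongr
        exact (abs_nonneg _).trans hq2

lemma resolventEq.elastic {P : Params} {lam : ℝ} {U Uhat : State}
    (h : resolventEq P lam U Uhat)
    (hphi : ∀ x ∈ Ioo 0 P.L, DifferentiableAt ℝ U.phi x)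
    (hPhi : ∀ x ∈ Ioo 0 P.L, DifferentiableAt ℝ U.Phi x) :
    ∀ᵐ x ∂(volume.restrict (Ioo 0 P.L)),
      Complex.I * lam * (deriv U.phi x + U.psi x) - deriv U.Phi x - U.Psi x =
        deriv Uhat.phi x + Uhat.psi x ∧
      P.rho1 * (Complex.I * lam * U.Phi x) -
        P.k * deriv (fun y => deriv U.phi y + U.psi y) x + P.gamma * deriv U.theta x =
        P.rho1 * Uhat.Phi x := by
  filter_upwards [h.1, h.2.1, ae_restrict_mem measurableSet_Ioo] with x e1 e2 hx
  constructor
  · rw [← e1]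
    change _ = deriv ((Complex.I * (lam : ℂ)) • U.phi - U.Phi) x +
      (Complex.I * (lam : ℂ) * U.psi x - U.Psi x)
    rw [deriv_sub ((hphi x hx).const_smul _) (hPhi x hx), deriv_const_smul _ (hphi x hx),
      smul_eq_mul]
    ring
  · rw [← e2]
    change _ = P.rho1 * (Complex.I * (lam : ℂ) * U.Phi x -
      (((P.k / P.rho1 : ℝ) : ℂ) * deriv (fun y => deriv U.phi y + U.psi y) x -
      ((P.gamma / P.rho1 : ℝ) : ℂ) * deriv U.theta x))
    have : (P.rho1 : ℂ) ≠ 0 := by exact_mod_cast P.hrho1.ne'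
    push_cast
    field_simp
    ring

/-- The observability estimate in terms of the individual `L²` norms. -/
lemma Iterm_le {P : Params} {lam : ℝ} {U Uhat : State} (hU : memDomA P BC.dirichlet U)
    (hUhat : memHS P BC.dirichlet Uhat) (h : resolventEq P lam U Uhat) :
    P.k * (P.L / 2) * Iterm P U ≤
      P.k * (L2norm P.L (fun x => deriv U.phi x + U.psi x) *
        L2norm P.L (fun x => deriv U.phi x + U.psi x)) +
      P.rho1 * (L2norm P.L U.Phi * L2norm P.L U.Phi) +
      P.L * (P.gamma * (L2norm P.L (fun x => deriv U.phi x + U.psi x) *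
          L2norm P.L (deriv U.theta)) +
        P.rho1 * (L2norm P.L (fun x => deriv U.phi x + U.psi x) * L2norm P.L Uhat.Phi) +
        P.rho1 * (L2norm P.L U.Phi * L2norm P.L U.Psi) +
        P.rho1 * (L2norm P.L U.Phi *
          L2norm P.L (fun x => deriv Uhat.phi x + Uhat.psi x))) := by
  obtain ⟨-, ⟨hphi, hphi'⟩, ⟨hPhi, hPhi0, hPhiL⟩, -, -, -, -, ⟨hpsi, -⟩, ⟨hPsi, -⟩,
    ⟨htheta, -⟩, -⟩ := hU
  obtain ⟨⟨hphih, -⟩, hPhih, ⟨⟨hpsih, -⟩, -⟩, -⟩ := hUhat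
  set w : ℝ → ℂ := fun x => deriv U.phi x + U.psi x with hw
  set wh : ℝ → ℂ := fun x => deriv Uhat.phi x + Uhat.psi x with hwh
  have w2 : memL2 P.L w := hphi.2.2.2.add hpsi.2.2.1
  have wh2 : memL2 P.L wh := hphih.2.2.2.add hpsih.2.2.1
  have F2 := hPhi.2.2.1
  have P2 := hPsi.2.2.1
  have t2 := htheta.2.2.2
  have wc : ContinuousOn w (Icc 0 P.L) := hphi'.1.add hpsi.1
  have wd : ∀ x ∈ Ioo 0 P.L, DifferentiableAt ℝ w x := fun x hx =>
    (hphi'.2.1 x hx).add (hpsi.2.1 x hx)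
  set G : ℝ → ℝ := fun x =>
    (x - P.L / 2) * (P.k * ‖w x‖ ^ 2 + P.rho1 * ‖U.Phi x‖ ^ 2) with hG
  set B : ℝ → ℝ := fun x => P.k * (‖w x‖ * ‖w x‖) + P.rho1 * (‖U.Phi x‖ * ‖U.Phi x‖) +
    P.L * (P.gamma * (‖w x‖ * ‖deriv U.theta x‖) + P.rho1 * (‖w x‖ * ‖Uhat.Phi x‖) +
      P.rho1 * (‖U.Phi x‖ * ‖U.Psi x‖) + P.rho1 * (‖U.Phi x‖ * ‖wh x‖)) with hB
  have Gc : ContinuousOn G (Icc 0 P.L) :=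
    (continuousOn_id.sub continuousOn_const).mul
      (((wc.norm.pow 2).const_mul _).add ((hPhi.1.norm.pow 2).const_mul _))
  have Gd : ∀ x ∈ Ioo 0 P.L, HasDerivAt G
      ((P.k * ‖w x‖ ^ 2 + P.rho1 * ‖U.Phi x‖ ^ 2) +
        (x - P.L / 2) * (P.k * (2 * inner ℝ (w x) (deriv w x)) +
          P.rho1 * (2 * inner ℝ (U.Phi x) (deriv U.Phi x)))) x := by
    intro x hx
    have d := ((hasDerivAt_id x).sub_const (P.L / 2)).mul
      (((wd x hx).hasDerivAt.norm_sq.const_mul P.k).add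
        ((hPhi.2.1 x hx).hasDerivAt.norm_sq.const_mul P.rho1))
    exact d.congr_deriv (by simp)
  have i1 := (w2.integrableOn_norm_mul_norm w2).const_mul P.k
  have i2 := (F2.integrableOn_norm_mul_norm F2).const_mul P.rho1
  have i3 := (w2.integrableOn_norm_mul_norm t2).const_mul P.gamma
  have i4 := (w2.integrableOn_norm_mul_norm hPhih).const_mul P.rho1
  have i5 := (F2.integrableOn_norm_mul_norm P2).const_mul P.rho1
  have i6 := (F2.integrableOn_norm_mul_norm wh2).const_mul P.rho1
  have Bi : IntegrableOn B (Ioo 0 P.L) :=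
    (i1.add i2).add ((((i3.add i4).add i5).add i6).const_mul P.L)
  have bound : ∀ᵐ x ∂(volume.restrict (Ioo 0 P.L)), ‖deriv G x‖ ≤ B x := by
    filter_upwards [h.elastic hphi.2.1 hPhi.2.1, ae_restrict_mem measurableSet_Ioo]
      with x ⟨e1, e2⟩ hx
    rw [(Gd x hx).deriv, Real.norm_eq_abs]
    have hq : |x - P.L / 2| ≤ P.L / 2 := abs_le.2 ⟨by linarith [hx.1], by linarith [hx.2]⟩
    have := multiplier_pointwise_bound P.hrho1 P.hgamma hq e1 e2
    rwa [abs_of_pos P.hk] at this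
  have G'i : IntegrableOn (deriv G) (Ioo 0 P.L) :=
    Integrable.mono' Bi (measurable_deriv G).aestronglyMeasurable bound
  have ftc : ∫ x in (0)..P.L, deriv G x = G P.L - G 0 :=
    intervalIntegral.integral_eq_sub_of_hasDerivAt_of_le P.hL.le Gc
      (fun x hx => (Gd x hx).differentiableAt.hasDerivAt)
      ((intervalIntegrable_iff_integrableOn_Ioo_of_le P.hL.le).2 G'i)
  have ends : G P.L - G 0 = P.k * (P.L / 2) * Iterm P U := by
    simp only [hG, hw, Iterm, hPhi0, hPhiL, norm_zero]
    ring
  rw [← ends, ← ftc, intervalIntegral.integral_of_le P.hL.le, integral_Ioc_eq_integral_Ioo]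
  have hBint : ∫ x in Ioo 0 P.L, B x =
      P.k * (∫ x in Ioo 0 P.L, ‖w x‖ * ‖w x‖) +
      P.rho1 * (∫ x in Ioo 0 P.L, ‖U.Phi x‖ * ‖U.Phi x‖) +
      P.L * (P.gamma * (∫ x in Ioo 0 P.L, ‖w x‖ * ‖deriv U.theta x‖) +
        P.rho1 * (∫ x in Ioo 0 P.L, ‖w x‖ * ‖Uhat.Phi x‖) +
        P.rho1 * (∫ x in Ioo 0 P.L, ‖U.Phi x‖ * ‖U.Psi x‖) +
        P.rho1 * (∫ x in Ioo 0 P.L, ‖U.Phi x‖ * ‖wh x‖)) := by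
    simp only [hB]
    rw [integral_add, integral_add i1 i2, integral_const_mul P.L, integral_add, integral_add,
      integral_add i3 i4]
    · simp only [integral_const_mul]
    exacts [i3.add i4, i5, (i3.add i4).add i5, i6, i1.add i2,
      (((i3.add i4).add i5).add i6).const_mul P.L]
  calc ∫ x in Ioo 0 P.L, deriv G x ≤ ∫ x in Ioo 0 P.L, B x :=
        integral_mono_ae G'i Bi (bound.mono fun x hx => (le_abs_self _).trans hx)
    _ ≤ _ := by
        rw [hBint]
        have := P.hk.le
        have := P.hL.le
        have := P.hrho1.le
        have := P.hgamma.le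
        gcongr
        · exact w2.integral_norm_mul_norm_le w2
        · exact F2.integral_norm_mul_norm_le F2
        · exact w2.integral_norm_mul_norm_le t2
        · exact w2.integral_norm_mul_norm_le hPhih
        · exact F2.integral_norm_mul_norm_le P2
        · exact F2.integral_norm_mul_norm_le wh2

/-- **Lemma 4.7(i) (elastic observability-type inequality).**  Full Dirichlet
boundary conditions.  If `U ∈ D(𝒜)` satisfies the resolvent equation
`iλU − 𝒜U = Û`, then with `𝓘(φ,ψ) = |φx(0)+ψ(0)|² + |φx(L)+ψ(L)|²` one has
`𝓘(φ,ψ) ≤ c‖U‖²_ℋ + c‖U‖_ℋ‖Û‖_ℋ + c‖U‖_ℋ‖θx‖` for some structural constant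
`c > 0` independent of `λ`, `U` and `Û`. -/
theorem elastic_observability_I (P : Params) :
    ∃ c : ℝ, 0 < c ∧ ∀ (lam : ℝ) (U Uhat : State),
      memDomA P BC.dirichlet U → memHS P BC.dirichlet Uhat →
      resolventEq P lam U Uhat →
      Iterm P U ≤ c * hnormSq P U + c * hnorm P U * hnorm P Uhat +
        c * hnorm P U * L2norm P.L (deriv U.theta) := by
  obtain ⟨M, hM, hbd⟩ := exists_L2norm_le_hnorm P
  have hL := P.hL
  have hk := P.hk
  have hr := P.hrho1
  have hg := P.hgamma
  have hc : 0 < P.k * (P.L / 2) := by positivity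
  set C : ℝ := P.k * M ^ 2 + P.rho1 * M ^ 2 + P.L * (P.gamma * M + 2 * P.rho1 * M ^ 2) with hC
  refine ⟨C / (P.k * (P.L / 2)), by positivity, fun lam U Uhat hU hUhat hres => ?_⟩
  have main := Iterm_le hU hUhat hres
  obtain ⟨a1, a2, a3⟩ := hbd U
  obtain ⟨b1, b2, -⟩ := hbd Uhat
  have hN2 : hnormSq P U = hnorm P U ^ 2 := (Real.sq_sqrt (hnormSq_nonneg P U)).symm
  have hN : 0 ≤ hnorm P U := Real.sqrt_nonneg _
  have hNh : 0 ≤ hnorm P Uhat := Real.sqrt_nonneg _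
  have hT := L2norm_nonneg P.L (deriv U.theta)
  have n1 := L2norm_nonneg P.L (fun x => deriv U.phi x + U.psi x)
  have n2 := L2norm_nonneg P.L U.Phi
  have n3 := L2norm_nonneg P.L U.Psi
  have n4 := L2norm_nonneg P.L Uhat.Phi
  have n5 := L2norm_nonneg P.L (fun x => deriv Uhat.phi x + Uhat.psi x)
  rw [hN2]
  generalize hnorm P U = N at *
  generalize hnorm P Uhat = Nh at *
  generalize L2norm P.L (deriv U.theta) = T at *
  have step : P.k * (P.L / 2) * Iterm P U ≤ C * (N ^ 2 + N * Nh + N * T) :=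
    calc P.k * (P.L / 2) * Iterm P U
        ≤ P.k * ((M * N) * (M * N)) + P.rho1 * ((M * N) * (M * N)) +
          P.L * (P.gamma * ((M * N) * T) + P.rho1 * ((M * N) * (M * Nh)) +
            P.rho1 * ((M * N) * (M * N)) + P.rho1 * ((M * N) * (M * Nh))) := by
          refine main.trans ?_
          gcongr
      _ = (P.k * M ^ 2 + P.rho1 * M ^ 2 + P.L * P.rho1 * M ^ 2) * N ^ 2 +
          (2 * P.L * P.rho1 * M ^ 2) * (N * Nh) + (P.L * P.gamma * M) * (N * T) := by ring
      _ ≤ C * N ^ 2 + C * (N * Nh) + C * (N * T) := by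
          have p1 : 0 < P.k * M ^ 2 := by positivity
          have p2 : 0 < P.rho1 * M ^ 2 := by positivity
          have p3 : 0 < P.L * P.rho1 * M ^ 2 := by positivity
          have p4 : 0 < P.L * P.gamma * M := by positivity
          gcongr <;> rw [hC] <;> linarith
      _ = C * (N ^ 2 + N * Nh + N * T) := by ring
  calc Iterm P U ≤ C * (N ^ 2 + N * Nh + N * T) / (P.k * (P.L / 2)) :=
        (le_div_iff₀' hc).2 step
    _ = _ := by ring

end TGP
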